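/- Let (X,d) be a metric space, f : X → X a map, and φ : X → ℝ a γ-Hölder function: there are γ ∈ (0,1] and C₀ ≥ 0 with |φ(u) − φ(v)| ≤ C₀ · d(u,v)^γ for all u,v ∈ X. Let C > 0, r > 0, ξ ∈ (0,1), and δ₀ > 0. Suppose x, y ∈ X and n ∈ ℕ satisfy d(f^k x, f^k y) ≤ 2 max{C e^{−rk/2} δ₀, ξ^{n−k} δ₀} for every 0 ≤ k < n. Then |∑_{k=0}^{n-1} φ(f^k x) − ∑_{k=0}^{n-1} φ(f^k y)| ≤ K, where K = C₀ (2δ₀)^γ ( max(1,C)^γ / (1 − e^{−γ r/2}) + ξ^γ / (1 − ξ^γ) ) is independent of x, y and n. In particular, φ has the Bowen property at scale ε on any collection G ⊆ X × ℕ of orbit segments such that every (x,n) ∈ G and every y with max_{0≤k<n} d(f^k x, f^k y) < ε satisfy the above closeness estimate. -/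

import Mathlib

open Filter Set

/-- Birkhoff sum `∑_{k=0}^{n-1} φ(f^k x)`. -/
noncomputable def birkhoff {X : Type*} (f : X → X) (φ : X → ℝ) (n : ℕ) (x : X) : ℝ :=
  ∑ k ∈ Finset.range n, φ (f^[k] x)

/-- The n-th Bowen metric `d_n(x,y) = max_{0 ≤ k < n} d(f^k x, f^k y)`. -/
noncomputable def bowenDist {X : Type*} [MetricSpace X] (f : X → X) (n : ℕ) (x y : X) : ℝ :=
  ⨆ k : Fin n, dist (f^[k] x) (f^[k] y)

/-- The partial sums of a geometric series of ratio `q ∈ [0, 1)` are at most `1 / (1 - q)`. -/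
lemma sum_range_pow_le_inv_one_sub {q : ℝ} (h0 : 0 ≤ q) (h1 : q < 1) (n : ℕ) :
    ∑ k ∈ Finset.range n, q ^ k ≤ (1 - q)⁻¹ :=
  sum_le_hasSum _ (fun _ _ => pow_nonneg h0 _) (hasSum_geometric_of_lt_one h0 h1)

lemma sum_range_pow_sub_le {s : ℝ} (h0 : 0 ≤ s) (h1 : s < 1) (n : ℕ) :
    ∑ k ∈ Finset.range n, s ^ (n - k) ≤ s / (1 - s) := by
  have h : ∑ k ∈ Finset.range n, s ^ (n - k) = s * ∑ k ∈ Finset.range n, s ^ k := by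
    rw [← Finset.sum_range_reflect (fun k => s ^ k), Finset.mul_sum]
    refine Finset.sum_congr rfl fun k hk => ?_
    have hk := Finset.mem_range.1 hk
    rw [← pow_succ']
    congr 1
    omega
  rw [h, div_eq_mul_inv]
  exact mul_le_mul_of_nonneg_left (sum_range_pow_le_inv_one_sub h0 h1 n) h0

/-- A `γ`-th power of the two-sided exponential bound is at most the sum of the two
corresponding geometric terms. -/
lemma rpow_two_mul_max_le {γ C r ξ δ d : ℝ} (hγ : 0 < γ) (hξ : 0 < ξ)
    (hδ : 0 < δ) (hd : 0 ≤ d) (k m : ℕ)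
    (h : d ≤ 2 * max (C * Real.exp (-(r * k) / 2) * δ) (ξ ^ m * δ)) :
    d ^ γ ≤ (2 * δ) ^ γ *
      ((max 1 C) ^ γ * Real.exp (-(γ * r) / 2) ^ k + (ξ ^ γ) ^ m) := by
  have hM : 0 < max 1 C := lt_max_of_lt_left one_pos
  have hexp : Real.exp (-(r * k) / 2) ^ γ = Real.exp (-(γ * r) / 2) ^ k := by
    rw [← Real.exp_mul, ← Real.exp_nat_mul]
    ring_nf
  have hpow : (ξ ^ m) ^ γ = (ξ ^ γ) ^ m := by
    rw [← Real.rpow_natCast, ← Real.rpow_natCast, ← Real.rpow_mul hξ.le,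
      ← Real.rpow_mul hξ.le, mul_comm]
  have ha : 0 ≤ (max 1 C) ^ γ * Real.exp (-(γ * r) / 2) ^ k := by positivity
  have hb : 0 ≤ (ξ ^ γ) ^ m := by positivity
  rw [mul_max_of_nonneg _ _ zero_le_two] at h
  rcases le_max_iff.1 h with h | h
  · calc d ^ γ ≤ (2 * δ * (max 1 C * Real.exp (-(r * k) / 2))) ^ γ := by
          refine Real.rpow_le_rpow hd (h.trans ?_) hγ.le
          calc 2 * (C * Real.exp (-(r * k) / 2) * δ)
              = 2 * δ * (C * Real.exp (-(r * k) / 2)) := by ring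
            _ ≤ _ := by gcongr; exact le_max_right _ _
      _ = (2 * δ) ^ γ * ((max 1 C) ^ γ * Real.exp (-(γ * r) / 2) ^ k) := by
          rw [Real.mul_rpow (by positivity) (by positivity), Real.mul_rpow hM.le (by positivity),
            hexp]
      _ ≤ _ := by gcongr; linarith
  · calc d ^ γ ≤ (2 * δ * ξ ^ m) ^ γ :=
          Real.rpow_le_rpow hd (h.trans_eq (by ring)) hγ.le
      _ = (2 * δ) ^ γ * (ξ ^ γ) ^ m := by
          rw [Real.mul_rpow (by positivity) (by positivity), hpow]
      _ ≤ _ := by gcongr; linarith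

/-- If `φ` is `γ`-Hölder with constant `C₀` and the orbits of `x` and `y` satisfy the
exponential closeness estimate
`d(f^k x, f^k y) ≤ 2 max{C e^{−rk/2} δ₀, ξ^{n−k} δ₀}` for `0 ≤ k < n`, then the Birkhoff
sums of `φ` along the two orbit segments differ by at most the constant
`K = C₀ (2δ₀)^γ ( max(1,C)^γ / (1 − e^{−γr/2}) + ξ^γ / (1 − ξ^γ) )`,
which is independent of `x`, `y` and `n`.  In particular `φ` has the Bowen property
at scale `ε` on any collection `G` of orbit segments along which this closeness
estimate holds for Bowen-`ε`-close points. -/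
theorem birkhoff_diff_bounded_of_holder {X : Type*} [MetricSpace X] (f : X → X) (φ : X → ℝ)
    (γ C₀ : ℝ) (hγ : 0 < γ) (hγ' : γ ≤ 1) (hC₀ : 0 ≤ C₀)
    (hφ : ∀ u v : X, |φ u - φ v| ≤ C₀ * dist u v ^ γ)
    (C r ξ δ₀ : ℝ) (hC : 0 < C) (hr : 0 < r) (hξ : 0 < ξ) (hξ' : ξ < 1) (hδ₀ : 0 < δ₀) :
    (∀ (x y : X) (n : ℕ),
      (∀ k : ℕ, k < n →
        dist (f^[k] x) (f^[k] y) ≤ 2 * max (C * Real.exp (-(r * k) / 2) * δ₀) (ξ ^ (n - k) * δ₀)) →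
      |birkhoff f φ n x - birkhoff f φ n y| ≤
        C₀ * (2 * δ₀) ^ γ *
          ((max 1 C) ^ γ / (1 - Real.exp (-(γ * r) / 2)) + ξ ^ γ / (1 - ξ ^ γ))) ∧
    (∀ ε : ℝ, 0 < ε → ∀ G : Set (X × ℕ),
      (∀ p ∈ G, ∀ y : X, bowenDist f p.2 p.1 y < ε →
        ∀ k : ℕ, k < p.2 →
          dist (f^[k] p.1) (f^[k] y) ≤
            2 * max (C * Real.exp (-(r * k) / 2) * δ₀) (ξ ^ (p.2 - k) * δ₀)) →
      ∃ K > 0, ∀ p ∈ G, ∀ y : X, bowenDist f p.2 p.1 y < ε →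
        |birkhoff f φ p.2 p.1 - birkhoff f φ p.2 y| ≤ K) := by
  have hq : Real.exp (-(γ * r) / 2) < 1 := by
    rw [Real.exp_lt_one_iff]
    have := mul_pos hγ hr
    linarith
  have hs0 : 0 ≤ ξ ^ γ := by positivity
  have hs : ξ ^ γ < 1 := Real.rpow_lt_one hξ.le hξ' hγ
  have key : ∀ (x y : X) (n : ℕ),
      (∀ k : ℕ, k < n →
        dist (f^[k] x) (f^[k] y) ≤ 2 * max (C * Real.exp (-(r * k) / 2) * δ₀) (ξ ^ (n - k) * δ₀)) →
      |birkhoff f φ n x - birkhoff f φ n y| ≤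
        C₀ * (2 * δ₀) ^ γ *
          ((max 1 C) ^ γ / (1 - Real.exp (-(γ * r) / 2)) + ξ ^ γ / (1 - ξ ^ γ)) := by
    intro x y n h
    calc |birkhoff f φ n x - birkhoff f φ n y|
        = |∑ k ∈ Finset.range n, (φ (f^[k] x) - φ (f^[k] y))| := by
          rw [birkhoff, birkhoff, Finset.sum_sub_distrib]
      _ ≤ ∑ k ∈ Finset.range n, |φ (f^[k] x) - φ (f^[k] y)| := Finset.abs_sum_le_sum_abs _ _
      _ ≤ ∑ k ∈ Finset.range n, C₀ * ((2 * δ₀) ^ γ *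
            ((max 1 C) ^ γ * Real.exp (-(γ * r) / 2) ^ k + (ξ ^ γ) ^ (n - k))) :=
          Finset.sum_le_sum fun k hk => (hφ _ _).trans <| mul_le_mul_of_nonneg_left
            (rpow_two_mul_max_le hγ hξ hδ₀ dist_nonneg k (n - k) (h k (Finset.mem_range.1 hk)))
            hC₀
      _ = C₀ * (2 * δ₀) ^ γ *
            ((max 1 C) ^ γ * ∑ k ∈ Finset.range n, Real.exp (-(γ * r) / 2) ^ k +
              ∑ k ∈ Finset.range n, (ξ ^ γ) ^ (n - k)) := by
          simp only [← mul_assoc C₀]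
          rw [← Finset.mul_sum, Finset.sum_add_distrib, ← Finset.mul_sum]
      _ ≤ _ := by
          rw [div_eq_mul_inv (max 1 C ^ γ)]
          gcongr
          · exact sum_range_pow_le_inv_one_sub (Real.exp_pos _).le hq n
          · exact sum_range_pow_sub_le hs0 hs n
  exact ⟨key, fun ε _ G hG => ⟨_, lt_max_of_lt_right one_pos, fun p hp y hy =>
    (key p.1 y p.2 (hG p hp y hy)).trans (le_max_left _ 1)⟩⟩
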